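/- Let (X_n) be integer-valued random variables with means μ_n, variances σ_n² → ∞, satisfying a Gaussian local limit theorem with speed ε_n → 0, i.e. sup_x |σ_n P(X_n = ⌊μ_n + xσ_n⌋) − e^{−x²/2}/√(2π)| ≤ ε_n. If X_n' is an independent copy of X_n, then P(X_n = X_n') = 1/(2√π σ_n) + O(ε_n/σ_n + 1/σ_n²). -/

import Mathlib

open MeasureTheory in
/-- The sum of `f` over the integers differs from its integral by at most the total variation. -/
theorem summable_int_and_abs_tsum_sub_integral_le {f f' : ℝ → ℝ}
    (hd : ∀ x, HasDerivAt f (f' x) x) (hf : Integrable f) (hf' : Integrable f') :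
    Summable (fun k : ℤ => f k) ∧ |∑' k : ℤ, f k - ∫ x, f x| ≤ ∫ x, |f' x| := by
  have h1 := hf.hasSum_intervalIntegral 0
  have h2 := hf'.abs.hasSum_intervalIntegral 0
  simp only [zero_add] at h1 h2
  have hcont : Continuous f := continuous_iff_continuousAt.2 fun x => (hd x).continuousAt
  have key : ∀ k : ℤ, ‖f k - ∫ x in (k : ℝ)..(k + 1), f x‖ ≤ ∫ x in (k : ℝ)..(k + 1), |f' x| := by
    intro k
    have hk : (k : ℝ) ≤ k + 1 := by linarith
    have e : f k - ∫ x in (k : ℝ)..(k + 1), f x = ∫ x in (k : ℝ)..(k + 1), (f k - f x) := by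
      rw [intervalIntegral.integral_sub (by simp) (hcont.intervalIntegrable _ _)]
      simp
    rw [e]
    have := intervalIntegral.norm_integral_le_of_norm_le_const (a := (k : ℝ)) (b := k + 1)
      (f := fun x => f k - f x) (C := ∫ x in (k : ℝ)..(k + 1), |f' x|) ?_
    · simpa using this
    intro x hx
    rw [Set.uIoc_of_le hk] at hx
    have e2 : ∫ t in (k : ℝ)..x, f' t = f x - f k :=
      intervalIntegral.integral_eq_sub_of_hasDerivAt (fun t _ => hd t) hf'.intervalIntegrable
    rw [norm_sub_rev, ← e2]
    calc ‖∫ t in (k : ℝ)..x, f' t‖ ≤ ∫ t in (k : ℝ)..x, ‖f' t‖ :=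
          intervalIntegral.norm_integral_le_integral_norm hx.1.le
      _ ≤ ∫ t in (k : ℝ)..(k + 1), |f' t| :=
          intervalIntegral.integral_mono_interval le_rfl hx.1.le hx.2
            (Filter.Eventually.of_forall fun t => abs_nonneg _) hf'.abs.intervalIntegrable
  have h3 : Summable fun k : ℤ => f k - ∫ x in (k : ℝ)..(k + 1), f x :=
    Summable.of_norm_bounded h2.summable key
  have hs : Summable (fun k : ℤ => f k) := by simpa using h3.add h1.summable
  refine ⟨hs, ?_⟩
  rw [← h1.tsum_eq, ← hs.tsum_sub h1.summable, ← h2.tsum_eq]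
  exact tsum_of_norm_bounded h2.summable.hasSum key

open MeasureTheory in
/-- Riemann sums of the Gaussian `exp (-b x²)` with mesh `1 / s` have error `O(1 / s)`. -/
theorem exists_abs_tsum_gaussian_sub_le {b : ℝ} (hb : 0 < b) :
    ∃ C : ℝ, 0 ≤ C ∧ ∀ s c : ℝ, 0 < s →
      Summable (fun k : ℤ => Real.exp (-b * ((k - c) / s) ^ 2)) ∧
      |∑' k : ℤ, Real.exp (-b * ((k - c) / s) ^ 2) - s * Real.sqrt (Real.pi / b)| ≤ C := by
  set h' : ℝ → ℝ := fun x => -2 * b * (x * Real.exp (-b * x ^ 2)) with hh'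
  have ih' : Integrable h' := (integrable_mul_exp_neg_mul_sq hb).const_mul _
  have ih : Integrable fun x : ℝ => Real.exp (-b * x ^ 2) := integrable_exp_neg_mul_sq hb
  have hd : ∀ x, HasDerivAt (fun x : ℝ => Real.exp (-b * x ^ 2)) (h' x) x := by
    intro x
    convert ((hasDerivAt_pow 2 x).const_mul (-b)).exp using 1
    simp only [hh']
    push_cast
    ring
  refine ⟨∫ x, |h' x|, integral_nonneg fun x => abs_nonneg _, fun s c hs => ?_⟩
  have hd2 : ∀ x, HasDerivAt (fun x : ℝ => Real.exp (-b * ((x - c) / s) ^ 2))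
      (h' ((x - c) / s) * (1 / s)) x := fun x =>
    (hd ((x - c) / s)).comp (h := fun x => (x - c) / s) x (((hasDerivAt_id x).sub_const c).div_const s)
  have i1 : Integrable fun x : ℝ => Real.exp (-b * ((x - c) / s) ^ 2) :=
    (ih.comp_div hs.ne').comp_sub_right c
  have i2 : Integrable fun x : ℝ => h' ((x - c) / s) * (1 / s) :=
    ((ih'.comp_div hs.ne').comp_sub_right c).mul_const _
  obtain ⟨hsum, hle⟩ := summable_int_and_abs_tsum_sub_integral_le hd2 i1 i2
  have e1 : ∫ x : ℝ, Real.exp (-b * ((x - c) / s) ^ 2) = s * Real.sqrt (Real.pi / b) := by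
    rw [integral_sub_right_eq_self (fun x : ℝ => Real.exp (-b * (x / s) ^ 2)) c,
      Measure.integral_comp_div (fun x : ℝ => Real.exp (-b * x ^ 2)) s, integral_gaussian,
      abs_of_pos hs, smul_eq_mul]
  have e2 : ∫ x : ℝ, |h' ((x - c) / s) * (1 / s)| = ∫ x, |h' x| := by
    simp only [abs_mul]
    rw [integral_mul_const,
      integral_sub_right_eq_self (fun x : ℝ => |h' (x / s)|) c,
      Measure.integral_comp_div (fun x : ℝ => |h' x|) s, abs_of_pos hs,
      abs_of_pos (one_div_pos.2 hs), smul_eq_mul]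
    field_simp
  rw [e1, e2] at hle
  exact ⟨hsum, hle⟩

open MeasureTheory in
theorem hasSum_toReal_measure_iUnion {Ω : Type*} [MeasurableSpace Ω] (μ : Measure Ω)
    [IsFiniteMeasure μ] {s : ℤ → Set Ω} (hs : ∀ k, MeasurableSet (s k))
    (hd : Pairwise (Function.onFun Disjoint s)) :
    HasSum (fun k => (μ (s k)).toReal) (μ (⋃ k, s k)).toReal := by
  rw [measure_iUnion hd hs]
  rw [ENNReal.tsum_toReal_eq fun k => measure_ne_top _ _]
  refine ENNReal.hasSum_toReal ?_
  rw [← measure_iUnion hd hs]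
  exact measure_ne_top _ _

open MeasureTheory in
theorem hasSum_toReal_measure_eq {Ω : Type*} [MeasurableSpace Ω] (μ : Measure Ω)
    [IsProbabilityMeasure μ] {X : Ω → ℤ} (hX : Measurable X) :
    HasSum (fun k => (μ {ω | X ω = k}).toReal) 1 := by
  have h := hasSum_toReal_measure_iUnion μ (s := fun k => {ω | X ω = k})
    (fun k => hX (measurableSet_singleton k)) (fun i j hij =>
      Set.disjoint_left.2 fun ω h1 h2 => hij (h1.symm.trans h2))
  have hu : (⋃ k, {ω | X ω = k}) = Set.univ := by ext; simp
  simpa [hu] using h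

open MeasureTheory ProbabilityTheory in
/-- The collision probability of two independent copies is the sum of the squared masses. -/
theorem hasSum_sq_toReal_measure_eq {Ω : Type*} [MeasurableSpace Ω] (μ : Measure Ω)
    [IsProbabilityMeasure μ] {X X' : Ω → ℤ} (hX : Measurable X) (hX' : Measurable X')
    (hid : IdentDistrib X X' μ μ) (hind : IndepFun X X' μ) :
    HasSum (fun k => (μ {ω | X ω = k}).toReal ^ 2) (μ {ω | X ω = X' ω}).toReal := by
  have h := hasSum_toReal_measure_iUnion μ (s := fun k => X ⁻¹' {k} ∩ X' ⁻¹' {k})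
    (fun k => (hX (measurableSet_singleton k)).inter (hX' (measurableSet_singleton k)))
    (fun i j hij => Set.disjoint_left.2 fun ω h1 h2 => hij (h1.1.symm.trans h2.1))
  have hu : (⋃ k, X ⁻¹' {k} ∩ X' ⁻¹' {k}) = {ω | X ω = X' ω} := by
    ext ω
    simp [eq_comm]
  rw [hu] at h
  convert h using 2 with k
  rw [hind.measure_inter_preimage_eq_mul _ _ (measurableSet_singleton k)
    (measurableSet_singleton k), ← hid.measure_preimage_eq (measurableSet_singleton k),
    ENNReal.toReal_mul, sq]
  rfl

theorem abs_tsum_sq_sub_le {p q : ℤ → ℝ} {δ P Q a : ℝ} (hp : ∀ k, 0 ≤ p k) (hq : ∀ k, 0 ≤ q k)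
    (hpq : ∀ k, |p k - q k| ≤ δ) (hsp : HasSum p P) (hsq : HasSum q Q)
    (hp2 : HasSum (fun k => p k ^ 2) a) {b : ℝ} (hq2 : HasSum (fun k => q k ^ 2) b) :
    |a - b| ≤ δ * (P + Q) := by
  have h := hp2.sub hq2
  rw [← h.tsum_eq, ← Real.norm_eq_abs]
  refine tsum_of_norm_bounded ((hsp.add hsq).mul_left δ) fun k => ?_
  rw [Real.norm_eq_abs, sq_sub_sq, abs_mul, abs_of_nonneg (add_nonneg (hp k) (hq k)), mul_comm]
  exact mul_le_mul_of_nonneg_right (hpq k) (add_nonneg (hp k) (hq k))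

open MeasureTheory ProbabilityTheory Asymptotics in
theorem stmt_12 {Ω : Type*} [MeasureSpace Ω] [IsProbabilityMeasure (ℙ : Measure Ω)]
    (X X' : ℕ → Ω → ℤ) (μn σn εn : ℕ → ℝ)
    (hmeas : ∀ n, Measurable (X n)) (hmeas' : ∀ n, Measurable (X' n))
    (hid : ∀ n, IdentDistrib (X n) (X' n))
    (hindep : ∀ n, IndepFun (X n) (X' n))
    (hmean : ∀ n, (∫ ω, ((X n ω : ℝ))) = μn n)
    (hvar : ∀ n, variance (fun ω => (X n ω : ℝ)) ℙ = σn n ^ 2)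
    (hσ : Filter.Tendsto σn Filter.atTop Filter.atTop)
    (hε : Filter.Tendsto εn Filter.atTop (nhds 0))
    (hLLT : ∀ n, ∀ x : ℝ,
      |σn n * (ℙ {ω | X n ω = ⌊μn n + x * σn n⌋}).toReal -
        Real.exp (-x ^ 2 / 2) / Real.sqrt (2 * Real.pi)| ≤ εn n) :
    (fun n => (ℙ {ω | X n ω = X' n ω}).toReal - 1 / (2 * Real.sqrt Real.pi * σn n))
      =O[Filter.atTop] (fun n => εn n / σn n + 1 / σn n ^ 2) := by
  obtain ⟨C₁, hC₁, h₁⟩ := exists_abs_tsum_gaussian_sub_le (b := 1 / 2) (by norm_num)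
  obtain ⟨C₂, hC₂, h₂⟩ := exists_abs_tsum_gaussian_sub_le (b := 1) one_pos
  refine IsBigO.of_bound (2 + C₁ + C₂) ?_
  filter_upwards [hσ.eventually_ge_atTop 1] with n hn
  have hs : 0 < σn n := by linarith
  have hε0 : 0 ≤ εn n := (abs_nonneg _).trans (hLLT n 0)
  set s := σn n
  set c := μn n
  set ε := εn n
  set r := Real.sqrt (2 * Real.pi) with hr
  have hr0 : 0 < r := Real.sqrt_pos.2 (by positivity)
  have hr1 : 1 ≤ r := Real.one_le_sqrt.2 (by linarith [Real.pi_gt_three])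
  have hr2 : r ^ 2 = 2 * Real.pi := Real.sq_sqrt (by positivity)
  obtain ⟨hsum₁, hle₁⟩ := h₁ s c hs
  obtain ⟨hsum₂, hle₂⟩ := h₂ s c hs
  set S₁ := ∑' k : ℤ, Real.exp (-(1 / 2) * ((k - c) / s) ^ 2)
  set S₂ := ∑' k : ℤ, Real.exp (-1 * ((k - c) / s) ^ 2)
  have hq : HasSum (fun k : ℤ => Real.exp (-(1 / 2) * ((k - c) / s) ^ 2) / (s * r))
      (S₁ / (s * r)) := hsum₁.hasSum.div_const _
  have hq2 : HasSum (fun k : ℤ => (Real.exp (-(1 / 2) * ((k - c) / s) ^ 2) / (s * r)) ^ 2)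
      (S₂ / (s * r) ^ 2) := by
    have e : (fun k : ℤ => (Real.exp (-(1 / 2) * ((k - c) / s) ^ 2) / (s * r)) ^ 2) =
        fun k : ℤ => Real.exp (-1 * ((k - c) / s) ^ 2) / (s * r) ^ 2 := by
      funext k
      rw [div_pow, ← Real.exp_nat_mul]
      congr 2
      push_cast
      ring
    rw [e]
    exact hsum₂.hasSum.div_const _
  have hpq : ∀ k : ℤ, |((ℙ : Measure Ω) {ω | X n ω = k}).toReal -
      Real.exp (-(1 / 2) * ((k - c) / s) ^ 2) / (s * r)| ≤ ε / s := by
    intro k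
    have h := hLLT n ((k - c) / s)
    have hk : c + (k - c) / s * s = k := by field_simp; ring
    rw [hk, Int.floor_intCast] at h
    change |s * _ - _| ≤ ε at h
    rw [le_div_iff₀ hs]
    refine le_of_eq_of_le ?_ h
    rw [← abs_of_pos hs, ← abs_mul, abs_of_pos hs,
      show -(1 / 2) * (((k : ℝ) - c) / s) ^ 2 = -((k - c) / s) ^ 2 / 2 by ring]
    congr 1
    field_simp
  have main := abs_tsum_sq_sub_le (fun k => ENNReal.toReal_nonneg) (fun k => by positivity) hpq
    (hasSum_toReal_measure_eq ℙ (hmeas n)) hq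
    (hasSum_sq_toReal_measure_eq ℙ (hmeas n) (hmeas' n) (hid n) (hindep n)) hq2
  have hS₁ : S₁ / (s * r) ≤ 1 + C₁ := by
    rw [div_le_iff₀ (by positivity)]
    have h := (abs_le.1 hle₁).2
    rw [show Real.pi / (1 / 2) = 2 * Real.pi by ring, ← hr] at h
    have : 1 ≤ s * r := one_le_mul_of_one_le_of_one_le hn hr1
    nlinarith
  have hS₂ : |S₂ / (s * r) ^ 2 - 1 / (2 * Real.sqrt Real.pi * s)| ≤ C₂ * (1 / s ^ 2) := by
    have hπ : Real.sqrt Real.pi ^ 2 = Real.pi := Real.sq_sqrt Real.pi_pos.le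
    have hπ0 : 0 < Real.sqrt Real.pi := Real.sqrt_pos.2 Real.pi_pos
    have e : S₂ / (s * r) ^ 2 - 1 / (2 * Real.sqrt Real.pi * s) =
        (S₂ - s * Real.sqrt (Real.pi / 1)) / (s * r) ^ 2 := by
      rw [mul_pow, hr2, div_one, ← hπ, Real.sqrt_sq hπ0.le]
      field_simp
    rw [e, abs_div, abs_of_pos (by positivity : 0 < (s * r) ^ 2), mul_one_div]
    refine div_le_div₀ hC₂ hle₂ (by positivity) ?_
    rw [mul_pow]
    exact le_mul_of_one_le_right (by positivity) (one_le_pow₀ hr1)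
  have hδ : 0 ≤ ε / s := by positivity
  have hs2 : 0 ≤ 1 / s ^ 2 := by positivity
  rw [Real.norm_eq_abs, Real.norm_eq_abs, abs_of_nonneg (add_nonneg hδ hs2)]
  refine (abs_sub_le _ (S₂ / (s * r) ^ 2) _).trans ((add_le_add main hS₂).trans ?_)
  have hm : ε / s * (1 + S₁ / (s * r)) ≤ ε / s * (2 + C₁) :=
    mul_le_mul_of_nonneg_left (by linarith) hδ
  nlinarith [mul_nonneg hC₂ hδ, mul_nonneg hC₁ hs2]
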